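/- For every p > 2, every z ≥ 1 and every x ≥ z one has ψ(z,x) ≤ 0. -/

import Mathlib

/-- `f(t) = t²/2 - tᵖ/p`. -/
noncomputable def f (p t : ℝ) : ℝ := t ^ 2 / 2 - t ^ p / p

/-- First derivative: `f'(t) = t - t^(p-1)`. -/
noncomputable def f' (p t : ℝ) : ℝ := t - t ^ (p - 1)

/-- Second derivative: `f''(t) = 1 - (p-1) t^(p-2)`. -/
noncomputable def f'' (p t : ℝ) : ℝ := 1 - (p - 1) * t ^ (p - 2)

/-- `ψ(z,x) = -f'(x)² - 3 f'(z) (f'(x) + (z-x) f''(x))`. -/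
noncomputable def ψ (p z x : ℝ) : ℝ :=
  -(f' p x) ^ 2 - 3 * f' p z * (f' p x + (z - x) * f'' p x)

/-- `log R ≤ √R - 1/√R` for `R ≥ 1`, in terms of `t = (log R) / 2`. -/
lemma two_mul_mul_exp_le {t : ℝ} (ht : 0 ≤ t) :
    2 * t * Real.exp t ≤ Real.exp t ^ 2 - 1 := by
  have h := Real.self_le_sinh_iff.2 ht
  rw [Real.sinh_eq] at h
  have hinv : Real.exp (-t) * Real.exp t = 1 := by rw [← Real.exp_add]; simp
  nlinarith [Real.exp_pos t]

lemma quadratic_nonneg_of_mul_sq_le {c d W r : ℝ} (hc : 0 ≤ c) (hcd : c ≤ d)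
    (hW : c * W ^ 2 ≤ d ^ 3) :
    0 ≤ r ^ 2 * d ^ 2 + 3 * c * (d - W * r) := by
  rcases (hc.trans hcd).eq_or_lt with hd | hd
  · obtain rfl : c = 0 := by linarith
    simp only [mul_zero, zero_mul, add_zero]
    positivity
  · refine nonneg_of_mul_nonneg_right (?_ : 0 ≤ d * _) hd
    have h₁ : 0 ≤ c * ((2 * (W * r) - 3 * d) ^ 2 + 3 * d ^ 2) := by positivity
    have h₂ := mul_le_mul_of_nonneg_right hW (sq_nonneg r)
    linarith

/-- The inequality `ψ ≤ 0` after scaling, with `q = p - 2`, `r = x / z` and `Z = z ^ q`. -/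
lemma scaled_nonneg {q r Z : ℝ} (hq : 0 ≤ q) (hr : 1 ≤ r) (hZ : 1 ≤ Z) :
    0 ≤ r ^ 2 * (Z * r ^ q - 1) ^ 2 +
      3 * (Z - 1) * (Z * r ^ q - 1 - Z * r ^ q * (q * (r - 1))) := by
  have hr₀ : 0 < r := by linarith
  have hlog : r - 1 ≤ r * Real.log r := by
    have h := mul_le_mul_of_nonneg_left (Real.one_sub_inv_le_log_of_pos hr₀) hr₀.le
    rwa [mul_sub, mul_inv_cancel₀ hr₀.ne', mul_one] at h
  obtain ⟨t, ht⟩ : ∃ t, t = q * Real.log r / 2 := ⟨_, rfl⟩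
  have ht₀ : 0 ≤ t := by
    rw [ht]
    have := Real.log_nonneg hr
    positivity
  have hR : r ^ q = Real.exp t ^ 2 := by
    rw [Real.rpow_def_of_pos hr₀, ← Real.exp_nat_mul, ht]
    congr 1
    push_cast
    ring
  have hqr : q * (r - 1) ≤ 2 * t * r := by
    have := mul_le_mul_of_nonneg_left hlog hq
    rw [ht]
    linarith
  have hS := two_mul_mul_exp_le ht₀
  have hS₁ : 1 ≤ Real.exp t := Real.one_le_exp ht₀
  rw [hR]
  generalize Real.exp t = S at hS hS₁
  have hR₁ : 1 ≤ S ^ 2 := one_le_pow₀ hS₁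
  have hZ₀ : 0 ≤ Z - 1 := by linarith
  have hd : Z - 1 ≤ Z * S ^ 2 - 1 := by nlinarith
  have hW : (Z - 1) * (Z * S ^ 2 * (2 * t)) ^ 2 ≤ (Z * S ^ 2 - 1) ^ 3 := by
    have h₁ : (Z - 1) * S ^ 2 ≤ Z * S ^ 2 - 1 := by linarith
    have h₂ : Z * (2 * t * S) ≤ Z * S ^ 2 - 1 := by nlinarith
    calc (Z - 1) * (Z * S ^ 2 * (2 * t)) ^ 2
        = ((Z - 1) * S ^ 2) * (Z * (2 * t * S)) ^ 2 := by ring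
      _ ≤ (Z * S ^ 2 - 1) * (Z * S ^ 2 - 1) ^ 2 := by
          gcongr
          linarith
      _ = (Z * S ^ 2 - 1) ^ 3 := by ring
  have h := quadratic_nonneg_of_mul_sq_le (r := r) hZ₀ hd hW
  have h' : 3 * (Z - 1) * (Z * S ^ 2) * (q * (r - 1)) ≤
      3 * (Z - 1) * (Z * S ^ 2) * (2 * t * r) := by
    gcongr
  linarith

/-- for every `p > 2`, every `z ≥ 1` and every `x ≥ z`, `ψ(z,x) ≤ 0`. -/
theorem stmt_1 (p : ℝ) (hp : 2 < p) (z x : ℝ) (hz : 1 ≤ z) (hx : z ≤ x) :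
    ψ p z x ≤ 0 := by
  obtain ⟨r, hr, rfl⟩ : ∃ r, 1 ≤ r ∧ x = z * r :=
    ⟨x / z, (one_le_div (by linarith)).2 hx, by field_simp⟩
  have hz₀ : 0 < z := by linarith
  have hr₀ : 0 < r := by linarith
  obtain ⟨q, rfl⟩ : ∃ q, p = q + 2 := ⟨p - 2, by ring⟩
  have hq : 0 ≤ q := by linarith
  have key := mul_nonneg (sq_nonneg z) (scaled_nonneg hq hr (Real.one_le_rpow hz hq))
  have e₁ : q + 2 - 1 = q + 1 := by ring
  have e₂ : q + 2 - 2 = q := by ring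
  simp only [ψ, f', f'', e₁, e₂]
  rw [Real.rpow_add_one (mul_pos hz₀ hr₀).ne', Real.rpow_add_one hz₀.ne',
    Real.mul_rpow hz₀.le hr₀.le]
  linarith
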